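/- Define the rational numbers q_n = Σ_{c=0}^{⌊n/2⌋} Σ_{t=2c}^{n} C(n,t) · h_{t,c} · ( Σ_{j=0}^{c} f_{n-t+c,j}·f_{n-t+c,c-j}/(j!·(c-j)!) ). Then q_n · 4·(log 2)^{2n+2} / (n!)^2 → e^{-(log 2)^2} as n → ∞, where log denotes the natural logarithm; equivalently, q_n / (f_n)^2 → e^{-(log 2)^2}, where f_n is the n-th Fubini number. (That is, q_n ~ e^{-(log 2)^2} · (n!)^2/(4·(log 2)^{2n+2}).) -/

import Mathlib

/-- Stirling numbers of the second kind. -/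
def S2 : ℕ → ℕ → ℕ
  | 0, 0 => 1
  | 0, _ + 1 => 0
  | _ + 1, 0 => 0
  | n + 1, k + 1 => (k + 1) * S2 n (k + 1) + S2 n k

/-- Generalized Fubini numbers: `f_{n,k} = ∑_{l=k}^n l! · S2(n-k, l-k)`. -/
def genFubini (n k : ℕ) : ℕ :=
  ∑ l ∈ Finset.Icc k n, Nat.factorial l * S2 (n - k) (l - k)

/-- The Fubini numbers (ordered Bell numbers): `f_n = f_{n,0}`. -/
def fubini (n : ℕ) : ℕ :=
  ∑ k ∈ Finset.range (n + 1), Nat.factorial k * S2 n k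

/-- `h t c = ∑_{k=c}^{t-c} (-1)^k (c+k)! · S2(t, c+k) · C(k-1, k-c)`. -/
def hQ (t c : ℕ) : ℚ :=
  ∑ k ∈ Finset.Icc c (t - c),
    (-1 : ℚ) ^ k * (Nat.factorial (c + k) : ℚ) * (S2 t (c + k) : ℚ) *
      (Nat.choose (k - 1) (k - c) : ℚ)

/-- `qr n = ∑_{c=0}^{⌊n/2⌋} ∑_{t=2c}^{n} C(n,t) · h_{t,c} ·
(∑_{j=0}^{c} f_{n-t+c,j} f_{n-t+c,c-j} / (j!(c-j)!))`. -/
def qr (n : ℕ) : ℚ :=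
  ∑ c ∈ Finset.range (n / 2 + 1), ∑ t ∈ Finset.Icc (2 * c) n,
    (Nat.choose n t : ℚ) * hQ t c *
      (∑ j ∈ Finset.range (c + 1),
        ((genFubini (n - t + c) j : ℚ) * (genFubini (n - t + c) (c - j) : ℚ)) /
          ((Nat.factorial j : ℚ) * (Nat.factorial (c - j) : ℚ)))


open Filter Topology Finset

lemma S2_eq_zero_of_lt : ∀ {n k : ℕ}, n < k → S2 n k = 0
  | _, 0, h => absurd h (Nat.not_lt_zero _)
  | 0, _ + 1, _ => by rw [S2]
  | n + 1, k + 1, h => by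
    rw [S2, S2_eq_zero_of_lt (show n < k + 1 by omega), S2_eq_zero_of_lt (show n < k by omega)]
    simp

lemma S2_self (n : ℕ) : S2 n n = 1 := by
  induction n with
  | zero => rw [S2]
  | succ n ih => rw [S2, ih, S2_eq_zero_of_lt (Nat.lt_succ_self n)]; simp

/-- Choosing the complement of the last block of an ordered set partition. -/
lemma sum_choose_mul_factorial_mul_S2 (m k : ℕ) :
    ∑ ij ∈ antidiagonal m, m.choose ij.1 * (k.factorial * S2 ij.1 k) =
      (k + 1).factorial * S2 m (k + 1) + k.factorial * S2 m k := by
  induction m generalizing k with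
  | zero => simp [S2]
  | succ m ih =>
    have key := Finset.sum_antidiagonal_choose_succ_mul (R := ℕ)
      (fun i _ => k.factorial * S2 i k) m
    simp only [Nat.cast_id] at key
    rw [key, ih k]
    have h2 : ∑ ij ∈ antidiagonal m, m.choose ij.2 * (k.factorial * S2 (ij.1 + 1) k) =
        ∑ ij ∈ antidiagonal m, m.choose ij.1 * (k.factorial * S2 (ij.1 + 1) k) := by
      refine Finset.sum_congr rfl fun ij hij => ?_
      rw [Nat.choose_symm_of_eq_add (mem_antidiagonal.1 hij).symm]
    rw [h2]
    cases k with
    | zero => simp [S2]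
    | succ k =>
      have h3 : ∑ ij ∈ antidiagonal m,
            m.choose ij.1 * ((k + 1).factorial * S2 (ij.1 + 1) (k + 1)) =
          (k + 1) * ∑ ij ∈ antidiagonal m,
            m.choose ij.1 * ((k + 1).factorial * S2 ij.1 (k + 1)) +
          (k + 1) * ∑ ij ∈ antidiagonal m, m.choose ij.1 * (k.factorial * S2 ij.1 k) := by
        rw [Finset.mul_sum, Finset.mul_sum, ← Finset.sum_add_distrib]
        refine Finset.sum_congr rfl fun ij _ => ?_
        rw [S2, Nat.factorial_succ k]
        ring
      rw [h3, ih, ih]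
      simp only [S2, Nat.factorial_succ]
      ring

lemma fubini_eq_sum_range {m N : ℕ} (h : m ≤ N) :
    fubini m = ∑ k ∈ range (N + 1), k.factorial * S2 m k := by
  refine Finset.sum_subset (by simpa using h) fun k _ hk => ?_
  rw [S2_eq_zero_of_lt (by simpa using hk), mul_zero]

lemma sum_choose_mul_fubini (m : ℕ) :
    ∑ ij ∈ antidiagonal m, m.choose ij.1 * fubini ij.1 + (if m = 0 then 1 else 0) =
      2 * fubini m := by
  have h : ∑ ij ∈ antidiagonal m, m.choose ij.1 * fubini ij.1 =
      ∑ k ∈ range (m + 1), ((k + 1).factorial * S2 m (k + 1) + k.factorial * S2 m k) := by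
    simp_rw [← sum_choose_mul_factorial_mul_S2]
    rw [Finset.sum_comm]
    refine Finset.sum_congr rfl fun ij hij => ?_
    rw [fubini_eq_sum_range (show ij.1 ≤ m by have := mem_antidiagonal.1 hij; omega),
      Finset.mul_sum]
  have h1 : fubini m = ∑ k ∈ range (m + 1), (k + 1).factorial * S2 m (k + 1) +
      (if m = 0 then 1 else 0) := by
    rw [fubini_eq_sum_range (Nat.le_succ m), Finset.sum_range_succ']
    cases m <;> simp [S2]
  rw [h, Finset.sum_add_distrib, add_right_comm, ← h1, two_mul]
  rfl

lemma genFubini_add (N k : ℕ) :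
    genFubini (N + k) k = ∑ i ∈ range (N + 1), (k + i).factorial * S2 N i := by
  unfold genFubini
  rw [← Finset.Ico_add_one_right_eq_Icc, Finset.sum_Ico_eq_sum_range]
  rw [show N + k + 1 - k = N + 1 by omega]
  refine Finset.sum_congr rfl fun i _ => ?_
  simp

lemma genFubini_zero (n : ℕ) : genFubini n 0 = fubini n := by
  simpa [fubini] using genFubini_add n 0

lemma genFubini_eq_zero_of_lt {n k : ℕ} (h : n < k) : genFubini n k = 0 := by
  unfold genFubini
  rw [Finset.Icc_eq_empty (by omega), Finset.sum_empty]

lemma two_mul_genFubini_succ (N k : ℕ) :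
    2 * genFubini (N + k + 1) (k + 1) =
      genFubini (N + k + 1) k + (k + 1) * genFubini (N + k) k := by
  have e1 := genFubini_add N (k + 1)
  have e2 := genFubini_add (N + 1) k
  rw [show N + (k + 1) = N + k + 1 by ring] at e1
  rw [show N + 1 + k = N + k + 1 by ring] at e2
  have e3 : ∑ i ∈ range (N + 1 + 1), (k + i).factorial * S2 (N + 1) i =
      ∑ i ∈ range (N + 1), (k + i).factorial * (i * S2 N i) +
        ∑ i ∈ range (N + 1), (k + i + 1).factorial * S2 N i := by
    rw [Finset.sum_range_succ']
    have : ∑ i ∈ range (N + 1), (k + i).factorial * (i * S2 N i) =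
        ∑ i ∈ range (N + 1), (k + (i + 1)).factorial * ((i + 1) * S2 N (i + 1)) := by
      have e := Finset.sum_range_succ' (fun i => (k + i).factorial * (i * S2 N i)) (N + 1)
      rw [Finset.sum_range_succ, S2_eq_zero_of_lt (Nat.lt_succ_self N)] at e
      simpa using e
    rw [this, ← Finset.sum_add_distrib]
    simp only [S2, mul_zero, add_zero]
    refine Finset.sum_congr rfl fun i _ => ?_
    rw [mul_add]; rfl
  rw [e1, e2, e3, genFubini_add, Finset.mul_sum, Finset.mul_sum, ← Finset.sum_add_distrib,
    ← Finset.sum_add_distrib]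
  refine Finset.sum_congr rfl fun i _ => ?_
  rw [show k + 1 + i = k + i + 1 by ring, Nat.factorial_succ]
  ring


/-- A renewal theorem: if the tail generating function `R = ∑ r k X ^ k` has nonnegative
coefficients, constant term `1` and sum `μ < 2`, then the coefficients of `1 / R` are summable,
with sum `1 / μ`. -/
lemma hasSum_of_sum_antidiagonal_mul_eq {r d : ℕ → ℝ} {μ : ℝ} (hr : ∀ k, 0 ≤ r k) (hr0 : r 0 = 1)
    (hμ : HasSum r μ) (hμ2 : μ < 2)
    (hd : ∀ m, ∑ ij ∈ antidiagonal m, r ij.1 * d ij.2 = if m = 0 then 1 else 0) :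
    HasSum d (1 / μ) := by
  have h2 : ∀ m, 2 * |d m| ≤ (if m = 0 then 1 else 0) +
      ∑ ij ∈ antidiagonal m, r ij.1 * |d ij.2| := by
    intro m
    cases m with
    | zero =>
      have := hd 0
      simp only [Finset.Nat.antidiagonal_zero, sum_singleton, hr0, one_mul, if_true] at this ⊢
      rw [this]; norm_num
    | succ m =>
      have h := hd (m + 1)
      rw [Finset.Nat.sum_antidiagonal_succ] at h ⊢
      simp only [hr0, one_mul, Nat.succ_ne_zero, if_false] at h ⊢
      have h3 : |∑ ij ∈ antidiagonal m, r (ij.1 + 1) * d ij.2| ≤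
          ∑ ij ∈ antidiagonal m, r (ij.1 + 1) * |d ij.2| := by
        refine (Finset.abs_sum_le_sum_abs _ _).trans_eq (Finset.sum_congr rfl fun ij _ => ?_)
        rw [abs_mul, abs_of_nonneg (hr _)]
      rw [← abs_neg, ← eq_neg_of_add_eq_zero_left h] at h3
      linarith
  have hS : ∀ M, ∑ m ∈ range M, |d m| ≤ 1 / (2 - μ) := by
    intro M
    rw [le_div_iff₀ (by linarith)]
    have h3 : ∑ m ∈ range M, ∑ ij ∈ antidiagonal m, r ij.1 * |d ij.2| ≤
        μ * ∑ m ∈ range M, |d m| := by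
      simp_rw [Finset.Nat.sum_antidiagonal_eq_sum_range_succ (fun i j => r i * |d j|)]
      rw [Finset.sum_range_diag_flip M (fun i j => r i * |d j|)]
      calc ∑ i ∈ range M, ∑ j ∈ range (M - i), r i * |d j|
          ≤ ∑ i ∈ range M, r i * ∑ j ∈ range M, |d j| := by
            refine Finset.sum_le_sum fun i _ => ?_
            rw [← Finset.mul_sum]
            refine mul_le_mul_of_nonneg_left ?_ (hr i)
            exact Finset.sum_le_sum_of_subset_of_nonneg
              (Finset.range_mono (Nat.sub_le M i)) fun _ _ _ => abs_nonneg _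
        _ ≤ μ * ∑ j ∈ range M, |d j| := by
            rw [← Finset.sum_mul]
            exact mul_le_mul_of_nonneg_right (sum_le_hasSum _ (fun i _ => hr i) hμ)
              (Finset.sum_nonneg fun _ _ => abs_nonneg _)
    have h4 : ∑ m ∈ range M, (if m = 0 then (1 : ℝ) else 0) ≤ 1 := by
      rw [Finset.sum_ite_eq']
      split_ifs <;> norm_num
    have h5 := Finset.sum_le_sum fun m (_ : m ∈ range M) => h2 m
    rw [← Finset.mul_sum, Finset.sum_add_distrib] at h5
    linarith
  have hd' : Summable fun m => ‖d m‖ := summable_of_sum_range_le (fun _ => abs_nonneg _) hS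
  have key := tsum_mul_tsum_eq_tsum_sum_antidiagonal_of_summable_norm
    (hμ.summable.norm) hd'
  simp_rw [hd] at key
  rw [tsum_ite_eq, hμ.tsum_eq] at key
  rw [← eq_one_div_of_mul_eq_one_right key]
  exact hd'.of_norm.hasSum

lemma hasSum_log_two_pow_div_factorial :
    HasSum (fun i : ℕ => Real.log 2 ^ i / i.factorial) 2 := by
  have h := NormedSpace.expSeries_div_hasSum_exp (Real.log 2)
  rwa [← Real.exp_eq_exp_ℝ, Real.exp_log two_pos] at h

lemma log_two_pos : 0 < Real.log 2 := Real.log_pos one_lt_two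

/-- The tails `∑_{i > k} (log 2) ^ i / i!` of the exponential series of `exp (log 2) = 2`. -/
noncomputable def logTwoTail (k : ℕ) : ℝ :=
  2 - ∑ i ∈ range (k + 1), Real.log 2 ^ i / i.factorial

lemma logTwoTail_nonneg (k : ℕ) : 0 ≤ logTwoTail k :=
  sub_nonneg.2 (sum_le_hasSum _ (fun i _ => by have := log_two_pos; positivity)
    hasSum_log_two_pow_div_factorial)

lemma logTwoTail_zero : logTwoTail 0 = 1 := by
  simp [logTwoTail]; norm_num

lemma logTwoTail_le (k : ℕ) :
    logTwoTail k ≤ 2 * (Real.log 2 ^ (k + 1) / (k + 1).factorial) := by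
  have h := (hasSum_nat_add_iff' (k + 1)).2 hasSum_log_two_pow_div_factorial
  have h' := hasSum_log_two_pow_div_factorial.mul_right (Real.log 2 ^ (k + 1) / (k + 1).factorial)
  refine hasSum_le (fun i => ?_) h h'
  have hL := log_two_pos
  rw [div_mul_div_comm, ← pow_add]
  refine div_le_div_of_nonneg_left (by positivity) (by positivity) ?_
  exact_mod_cast Nat.le_of_dvd (Nat.factorial_pos _) (Nat.factorial_mul_factorial_dvd_factorial_add _ _)

lemma sum_range_logTwoTail (K : ℕ) :
    ∑ k ∈ range K, logTwoTail k = K * logTwoTail K +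
      Real.log 2 * ∑ i ∈ range K, Real.log 2 ^ i / i.factorial := by
  induction K with
  | zero => simp
  | succ K ih =>
    have h1 : logTwoTail (K + 1) =
        logTwoTail K - Real.log 2 ^ (K + 1) / (K + 1).factorial := by
      simp only [logTwoTail, Finset.sum_range_succ _ (K + 1)]
      ring
    rw [Finset.sum_range_succ, ih, Finset.sum_range_succ _ K, h1, Nat.factorial_succ]
    have : (K.factorial : ℝ) ≠ 0 := by positivity
    have : (K : ℝ) + 1 ≠ 0 := by positivity
    push_cast
    field_simp
    ring

lemma hasSum_logTwoTail : HasSum logTwoTail (2 * Real.log 2) := by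
  rw [hasSum_iff_tendsto_nat_of_nonneg logTwoTail_nonneg]
  simp_rw [sum_range_logTwoTail]
  have hL := log_two_pos
  have h1 : Tendsto (fun K : ℕ => (K : ℝ) * logTwoTail K) atTop (𝓝 0) := by
    have h2 : Tendsto (fun K : ℕ => 2 * Real.log 2 * (Real.log 2 ^ K / K.factorial)) atTop (𝓝 0) := by
      simpa using (hasSum_log_two_pow_div_factorial.summable.tendsto_atTop_zero).const_mul
        (2 * Real.log 2)
    refine squeeze_zero (fun K => mul_nonneg K.cast_nonneg (logTwoTail_nonneg K)) (fun K => ?_) h2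
    refine (mul_le_mul_of_nonneg_left (logTwoTail_le K) K.cast_nonneg).trans ?_
    have hK : (K : ℝ) / (K + 1) ≤ 1 := by
      rw [div_le_one (by positivity)]; linarith
    have e : (K : ℝ) * (2 * (Real.log 2 ^ (K + 1) / (K + 1).factorial)) =
        (K / (K + 1)) * (2 * Real.log 2 * (Real.log 2 ^ K / K.factorial)) := by
      rw [Nat.factorial_succ]
      have : (K.factorial : ℝ) ≠ 0 := by positivity
      push_cast
      field_simp
      ring
    rw [e]
    exact mul_le_of_le_one_left (by positivity) hK
  simpa [mul_comm] using
    h1.add ((hasSum_log_two_pow_div_factorial.tendsto_sum_nat).const_mul (Real.log 2))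

open PowerSeries in
lemma one_sub_X_mul_mk_logTwoTail :
    (1 - X) * PowerSeries.mk logTwoTail =
      2 - PowerSeries.mk fun i : ℕ => Real.log 2 ^ i / (i.factorial : ℝ) := by
  ext n
  have h2 : (2 : PowerSeries ℝ) = C 2 := (map_ofNat C 2).symm
  rw [sub_mul, one_mul, h2]
  cases n with
  | zero => simp [logTwoTail_zero]; norm_num
  | succ n =>
    simp only [map_sub, coeff_mk, coeff_succ_X_mul, coeff_C, Nat.succ_ne_zero, if_false]
    simp only [logTwoTail, Finset.sum_range_succ _ (n + 1)]
    ring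

open PowerSeries in
lemma two_sub_exp_mul_mk_fubini :
    (2 - PowerSeries.mk fun i : ℕ => Real.log 2 ^ i / (i.factorial : ℝ)) *
      PowerSeries.mk (fun m : ℕ => (fubini m : ℝ) * Real.log 2 ^ m / m.factorial) = 1 := by
  rw [sub_mul, sub_eq_iff_eq_add]
  ext m
  have h2 : (2 : PowerSeries ℝ) = C 2 := (map_ofNat C 2).symm
  rw [h2, coeff_C_mul, map_add, coeff_mul, coeff_one]
  simp only [coeff_mk]
  have h := sum_choose_mul_fubini m
  have h' : (∑ ij ∈ antidiagonal m, (m.choose ij.1 : ℝ) * fubini ij.1) +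
      (if m = 0 then 1 else 0) = 2 * fubini m := by exact_mod_cast h
  rw [← mul_div_assoc, ← mul_assoc, ← h', add_mul, add_div, add_comm, Finset.sum_mul,
    Finset.sum_div]
  congr 1
  · cases m <;> simp
  · rw [← Finset.Nat.sum_antidiagonal_swap]
    refine Finset.sum_congr rfl fun ij hij => ?_
    obtain rfl := mem_antidiagonal.1 hij
    simp only [Prod.fst_swap]
    rw [Nat.add_choose, Nat.cast_div (Nat.factorial_mul_factorial_dvd_factorial_add _ _)
      (by positivity)]
    have : ((ij.1 + ij.2).factorial : ℝ) ≠ 0 := by positivity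
    rw [pow_add]
    push_cast
    field_simp

open PowerSeries in
lemma fubini_mul_log_two_pow_div_factorial_le_one (m : ℕ) :
    (fubini m : ℝ) * Real.log 2 ^ m / m.factorial ≤ 1 := by
  have hL := log_two_pos
  have h : PowerSeries.mk logTwoTail *
      PowerSeries.mk (fun m : ℕ => (fubini m : ℝ) * Real.log 2 ^ m / m.factorial) =
      PowerSeries.mk 1 := by
    have h1 := mk_one_mul_one_sub_eq_one ℝ
    have h2 := two_sub_exp_mul_mk_fubini
    rw [← one_sub_X_mul_mk_logTwoTail] at h2
    linear_combination (PowerSeries.mk 1 : PowerSeries ℝ) * h2 - PowerSeries.mk logTwoTail *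
      PowerSeries.mk (fun m : ℕ => (fubini m : ℝ) * Real.log 2 ^ m / m.factorial) * h1
  have h3 := congrArg (coeff m) h
  rw [coeff_mul] at h3
  simp only [coeff_mk, Pi.one_apply] at h3
  rw [← h3]
  have := Finset.single_le_sum (f := fun ij : ℕ × ℕ => logTwoTail ij.1 *
    ((fubini ij.2 : ℝ) * Real.log 2 ^ ij.2 / ij.2.factorial))
    (fun ij _ => mul_nonneg (logTwoTail_nonneg _) (by positivity))
    (mem_antidiagonal.2 (zero_add m) : (0, m) ∈ antidiagonal m)
  simpa [logTwoTail_zero] using this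

open PowerSeries in
lemma tendsto_fubini_mul_log_two_pow_div_factorial :
    Tendsto (fun m : ℕ => (fubini m : ℝ) * Real.log 2 ^ m / m.factorial) atTop
      (𝓝 (1 / (2 * Real.log 2))) := by
  set A : PowerSeries ℝ :=
    PowerSeries.mk (fun m : ℕ => (fubini m : ℝ) * Real.log 2 ^ m / m.factorial) with hA
  have h1 : PowerSeries.mk logTwoTail * ((1 - X) * A) = 1 := by
    have h2 := two_sub_exp_mul_mk_fubini
    rw [← one_sub_X_mul_mk_logTwoTail] at h2
    linear_combination h2
  have hd := hasSum_of_sum_antidiagonal_mul_eq (d := fun n => coeff n ((1 - X) * A))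
    logTwoTail_nonneg logTwoTail_zero hasSum_logTwoTail
    (by linarith [Real.log_two_lt_d9]) (fun m => by
      have := congrArg (coeff m) h1
      rw [coeff_mul, coeff_one] at this
      simpa using this)
  have h3 := (hd.tendsto_sum_nat).comp (tendsto_add_atTop_nat 1)
  refine h3.congr fun m => ?_
  have h4 : A = PowerSeries.mk 1 * ((1 - X) * A) := by
    rw [← mul_assoc, mk_one_mul_one_sub_eq_one, one_mul]
  have h5 := congrArg (coeff m) h4
  rw [coeff_mul, Finset.Nat.sum_antidiagonal_eq_sum_range_succ
    (fun i j => coeff i (PowerSeries.mk 1 : PowerSeries ℝ) * coeff j ((1 - X) * A)),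
    ← Finset.sum_range_reflect] at h5
  rw [hA, coeff_mk, ← hA] at h5
  rw [h5, Function.comp_apply]
  refine Finset.sum_congr rfl fun i hi => ?_
  have : i ≤ m := Nat.lt_succ_iff.1 (mem_range.1 hi)
  rw [coeff_mk, Pi.one_apply, one_mul]
  congr 2
  omega


/-- `f_{m,k}` normalised by its exponential growth `m! / (log 2) ^ m`. -/
noncomputable def genFubiniRatio (m k : ℕ) : ℝ :=
  (genFubini m k : ℝ) * Real.log 2 ^ m / m.factorial

lemma genFubiniRatio_nonneg (m k : ℕ) : 0 ≤ genFubiniRatio m k := by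
  have := log_two_pos
  unfold genFubiniRatio
  positivity

lemma genFubiniRatio_zero (m : ℕ) :
    genFubiniRatio m 0 = (fubini m : ℝ) * Real.log 2 ^ m / m.factorial := by
  rw [genFubiniRatio, genFubini_zero]

lemma two_mul_genFubiniRatio_succ (N k : ℕ) :
    2 * genFubiniRatio (N + k + 1) (k + 1) = genFubiniRatio (N + k + 1) k +
      (k + 1) / (N + k + 1) * Real.log 2 * genFubiniRatio (N + k) k := by
  have h : (2 : ℝ) * genFubini (N + k + 1) (k + 1) =
      genFubini (N + k + 1) k + (k + 1) * genFubini (N + k) k := by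
    exact_mod_cast two_mul_genFubini_succ N k
  unfold genFubiniRatio
  rw [← mul_div_assoc, ← mul_assoc, h, Nat.factorial_succ, pow_succ]
  have : ((N + k).factorial : ℝ) ≠ 0 := by positivity
  have : (N : ℝ) + k + 1 ≠ 0 := by positivity
  push_cast
  field_simp

lemma genFubiniRatio_le_one (m k : ℕ) : genFubiniRatio m k ≤ 1 := by
  induction k generalizing m with
  | zero => rw [genFubiniRatio_zero]; exact fubini_mul_log_two_pow_div_factorial_le_one m
  | succ k ih =>
    rcases lt_or_ge m (k + 1) with hm | hm
    · simp [genFubiniRatio, genFubini_eq_zero_of_lt hm]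
    · obtain ⟨N, rfl⟩ := Nat.exists_eq_add_of_le' hm
      have h := two_mul_genFubiniRatio_succ N k
      have h1 : ((k : ℝ) + 1) / (N + k + 1) ≤ 1 := by
        rw [div_le_one (by positivity)]
        linarith [N.cast_nonneg (α := ℝ)]
      have hL := log_two_pos
      have h2 : ((k : ℝ) + 1) / (N + k + 1) * Real.log 2 * genFubiniRatio (N + k) k ≤ 1 :=
        mul_le_one₀ (mul_le_one₀ h1 hL.le (by linarith [Real.log_two_lt_d9]))
          (genFubiniRatio_nonneg _ _) (ih _)
      have h3 := ih (N + k + 1)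
      rw [← add_assoc]
      linarith

lemma tendsto_genFubiniRatio (k : ℕ) :
    Tendsto (fun m => genFubiniRatio m k) atTop (𝓝 (1 / (2 ^ (k + 1) * Real.log 2))) := by
  induction k with
  | zero =>
    simp_rw [genFubiniRatio_zero]
    simpa using tendsto_fubini_mul_log_two_pow_div_factorial
  | succ k ih =>
    rw [← tendsto_add_atTop_iff_nat (k + 1)]
    have h1 : Tendsto (fun N : ℕ => genFubiniRatio (N + k + 1) k) atTop
        (𝓝 (1 / (2 ^ (k + 1) * Real.log 2))) := ih.comp (tendsto_add_atTop_nat (k + 1))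
    have h2 : Tendsto (fun N : ℕ => genFubiniRatio (N + k) k) atTop
        (𝓝 (1 / (2 ^ (k + 1) * Real.log 2))) := ih.comp (tendsto_add_atTop_nat k)
    have h3 : Tendsto (fun N : ℕ => ((k : ℝ) + 1) / (N + k + 1)) atTop (𝓝 0) := by
      have := (tendsto_const_div_atTop_nhds_zero_nat ((k : ℝ) + 1)).comp
        (tendsto_add_atTop_nat (k + 1))
      refine this.congr fun N => ?_
      simp [add_assoc]
    have h4 := (h1.add ((h3.mul_const (Real.log 2)).mul h2)).div_const 2
    have hL := log_two_pos.ne'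
    have e : (1 / (2 ^ (k + 1) * Real.log 2) +
        0 * Real.log 2 * (1 / (2 ^ (k + 1) * Real.log 2))) / 2 =
        1 / (2 ^ (k + 1 + 1) * Real.log 2) := by
      field_simp
      ring
    rw [e] at h4
    refine h4.congr fun N => ?_
    rw [← two_mul_genFubiniRatio_succ, ← add_assoc]
    ring

/-- The inner convolution of `qr`, normalised. -/
noncomputable def genFubiniConv (m c : ℕ) : ℝ :=
  ∑ j ∈ range (c + 1), genFubiniRatio m j * genFubiniRatio m (c - j) /
    ((j.factorial : ℝ) * (c - j).factorial)

lemma sum_one_div_factorial_mul_factorial (c : ℕ) :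
    ∑ j ∈ range (c + 1), 1 / ((j.factorial : ℝ) * (c - j).factorial) =
      2 ^ c / c.factorial := by
  have h : ∑ j ∈ range (c + 1), (c.choose j : ℝ) = 2 ^ c := by
    exact_mod_cast Nat.sum_range_choose c
  rw [← h, Finset.sum_div]
  refine Finset.sum_congr rfl fun j hj => ?_
  rw [Nat.cast_choose ℝ (Nat.lt_succ_iff.1 (mem_range.1 hj))]
  have : (c.factorial : ℝ) ≠ 0 := by positivity
  field_simp

lemma genFubiniConv_nonneg (m c : ℕ) : 0 ≤ genFubiniConv m c :=
  Finset.sum_nonneg fun _ _ => div_nonneg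
    (mul_nonneg (genFubiniRatio_nonneg _ _) (genFubiniRatio_nonneg _ _)) (by positivity)

lemma genFubiniConv_le (m c : ℕ) : genFubiniConv m c ≤ 2 ^ c / c.factorial := by
  rw [← sum_one_div_factorial_mul_factorial]
  refine Finset.sum_le_sum fun j _ => ?_
  exact div_le_div_of_nonneg_right (mul_le_one₀ (genFubiniRatio_le_one _ _)
    (genFubiniRatio_nonneg _ _) (genFubiniRatio_le_one _ _)) (by positivity)

lemma tendsto_genFubiniConv (c : ℕ) :
    Tendsto (fun m => genFubiniConv m c) atTop
      (𝓝 (1 / (4 * Real.log 2 ^ 2 * c.factorial))) := by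
  have h : Tendsto (fun m => genFubiniConv m c) atTop (𝓝 (∑ j ∈ range (c + 1),
      1 / (2 ^ (j + 1) * Real.log 2) * (1 / (2 ^ (c - j + 1) * Real.log 2)) /
        ((j.factorial : ℝ) * (c - j).factorial))) :=
    tendsto_finsetSum _ fun j _ =>
      ((tendsto_genFubiniRatio j).mul (tendsto_genFubiniRatio (c - j))).div_const _
  convert h using 2
  have hL := log_two_pos.ne'
  have hs : ∀ j ∈ range (c + 1), 1 / (2 ^ (j + 1) * Real.log 2) *
      (1 / (2 ^ (c - j + 1) * Real.log 2)) / ((j.factorial : ℝ) * (c - j).factorial) =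
      1 / (2 ^ c * (4 * Real.log 2 ^ 2)) * (1 / ((j.factorial : ℝ) * (c - j).factorial)) := by
    intro j hj
    have hj' : j ≤ c := Nat.lt_succ_iff.1 (mem_range.1 hj)
    have e : (2 : ℝ) ^ c = 2 ^ j * 2 ^ (c - j) := by rw [← pow_add, Nat.add_sub_cancel' hj']
    rw [e, pow_succ, pow_succ]
    field_simp
    norm_num
  rw [Finset.sum_congr rfl hs, ← Finset.mul_sum, sum_one_div_factorial_mul_factorial]
  have : (c.factorial : ℝ) ≠ 0 := by positivity
  field_simp

/-- The factorial weight of the summand of `qr n` with `t = 2 * c + s` and `n = N + t`. -/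
noncomputable def factorialWeight (N c s : ℕ) : ℝ :=
  ((N + c).factorial : ℝ) ^ 2 / (N.factorial * (N + (2 * c + s)).factorial)

lemma factorialWeight_nonneg (N c s : ℕ) : 0 ≤ factorialWeight N c s := by
  unfold factorialWeight
  positivity

lemma factorialWeight_zero_right (N c : ℕ) :
    factorialWeight N c 0 = ∏ i ∈ range c, ((N + 1 + i : ℝ) / (N + c + 1 + i)) := by
  have h1 := Nat.factorial_mul_ascFactorial N c
  have h2 := Nat.factorial_mul_ascFactorial (N + c) c
  rw [Nat.ascFactorial_eq_prod_range] at h1 h2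
  have h1' : (N.factorial : ℝ) * ∏ i ∈ range c, (N + 1 + i : ℝ) = (N + c).factorial := by
    exact_mod_cast h1
  have h2' : ((N + c).factorial : ℝ) * ∏ i ∈ range c, (N + c + 1 + i : ℝ) =
      (N + c + c).factorial := by
    exact_mod_cast h2
  have hp : ∏ i ∈ range c, (N + c + 1 + i : ℝ) ≠ 0 :=
    Finset.prod_ne_zero_iff.2 fun i _ => by positivity
  rw [Finset.prod_div_distrib, factorialWeight, show N + (2 * c + 0) = N + c + c by ring,
    ← h2', ← h1']
  have : (N.factorial : ℝ) ≠ 0 := by positivity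
  have hq : ∏ i ∈ range c, (N + 1 + i : ℝ) ≠ 0 :=
    Finset.prod_ne_zero_iff.2 fun i _ => by positivity
  field_simp

lemma factorialWeight_zero_right_le_one (N c : ℕ) : factorialWeight N c 0 ≤ 1 := by
  rw [factorialWeight_zero_right]
  refine Finset.prod_le_one (fun i _ => by positivity) fun i _ => ?_
  rw [div_le_one (by positivity)]
  linarith [c.cast_nonneg (α := ℝ)]

lemma tendsto_factorialWeight_zero_right (c : ℕ) :
    Tendsto (fun N => factorialWeight N c 0) atTop (𝓝 1) := by
  simp_rw [factorialWeight_zero_right]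
  have hi : ∀ i ∈ range c,
      Tendsto (fun N : ℕ => (N + 1 + i : ℝ) / (N + c + 1 + i)) atTop (𝓝 1) := by
    intro i _
    have h : Tendsto (fun N : ℕ => 1 - (c : ℝ) / ((N + (c + 1 + i) : ℕ) : ℝ)) atTop
        (𝓝 (1 - 0)) :=
      ((tendsto_const_div_atTop_nhds_zero_nat (c : ℝ)).comp
        (tendsto_add_atTop_nat (c + 1 + i))).const_sub 1
    rw [sub_zero] at h
    refine h.congr fun N => ?_
    have : (N : ℝ) + c + 1 + i ≠ 0 := by positivity
    have : (N : ℝ) + (c + 1 + i) ≠ 0 := by positivity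
    push_cast
    field_simp
    ring
  simpa using tendsto_finsetProd _ hi

lemma factorialWeight_eq_mul (N c s : ℕ) :
    factorialWeight N c s =
      factorialWeight N c 0 * ((N + 2 * c).factorial / (N + (2 * c + s)).factorial) := by
  unfold factorialWeight
  have h1 : (N.factorial : ℝ) ≠ 0 := by positivity
  have h2 : ((N + 2 * c).factorial : ℝ) ≠ 0 := by positivity
  have h3 : ((N + (2 * c + s)).factorial : ℝ) ≠ 0 := by positivity
  rw [add_zero]
  field_simp

lemma factorialWeight_le (N c s : ℕ) : factorialWeight N c s ≤ 1 / s.factorial := by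
  rw [factorialWeight_eq_mul]
  refine (mul_le_of_le_one_left (by positivity) (factorialWeight_zero_right_le_one N c)).trans ?_
  rw [div_le_div_iff₀ (by positivity) (by positivity), one_mul, ← add_assoc]
  exact_mod_cast Nat.le_of_dvd (Nat.factorial_pos _)
    (Nat.factorial_mul_factorial_dvd_factorial_add _ _)

lemma factorialWeight_succ_le (N c s : ℕ) :
    factorialWeight N c (s + 1) ≤ 1 / (N + (2 * c + (s + 1)) : ℕ) := by
  rw [factorialWeight_eq_mul]
  refine (mul_le_of_le_one_left (by positivity) (factorialWeight_zero_right_le_one N c)).trans ?_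
  rw [div_le_div_iff₀ (by positivity) (by positivity), one_mul,
    show N + (2 * c + (s + 1)) = N + 2 * c + s + 1 by ring, Nat.factorial_succ, mul_comm]
  exact_mod_cast Nat.mul_le_mul_left _ (Nat.factorial_le (Nat.le_add_right _ _))

lemma hQ_two_mul_self (c : ℕ) : hQ (2 * c) c = (-1) ^ c * (2 * c).factorial := by
  unfold hQ
  rw [show 2 * c - c = c by omega, Finset.Icc_self, Finset.sum_singleton, ← two_mul, S2_self]
  simp

lemma abs_hQ_le {t c : ℕ} (h : 2 * c ≤ t) : |hQ t c| ≤ 2 ^ t * fubini t := by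
  calc |hQ t c| ≤ ∑ k ∈ Icc c (t - c), 2 ^ t * (((c + k).factorial * S2 t (c + k) : ℕ) : ℚ) := by
        refine (Finset.abs_sum_le_sum_abs _ _).trans (Finset.sum_le_sum fun k hk => ?_)
        have hk' := Finset.mem_Icc.1 hk
        have hc : ((k - 1).choose (k - c) : ℚ) ≤ 2 ^ t := by
          exact_mod_cast (Nat.choose_le_two_pow _ _).trans
            (Nat.pow_le_pow_right two_pos (by omega))
        rw [abs_mul, abs_mul, abs_mul, abs_pow, abs_neg, abs_one, one_pow, one_mul,
          Nat.abs_cast, Nat.abs_cast, Nat.abs_cast, Nat.cast_mul, mul_comm]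
        exact mul_le_mul_of_nonneg_right hc (by positivity)
    _ = 2 ^ t * ∑ l ∈ (Icc c (t - c)).map (addLeftEmbedding c),
          ((l.factorial * S2 t l : ℕ) : ℚ) := by
        rw [Finset.sum_map, Finset.mul_sum]
        rfl
    _ ≤ 2 ^ t * fubini t := by
        refine mul_le_mul_of_nonneg_left ?_ (by positivity)
        rw [fubini, Nat.cast_sum]
        refine Finset.sum_le_sum_of_subset_of_nonneg (fun l hl => ?_) fun _ _ _ => by positivity
        obtain ⟨k, hk, rfl⟩ := Finset.mem_map.1 hl
        have := Finset.mem_Icc.1 hk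
        simp only [addLeftEmbedding_apply, mem_range]
        omega

lemma abs_hQ_div_factorial_le {t c : ℕ} (h : 2 * c ≤ t) :
    |(hQ t c : ℝ) / t.factorial| ≤ (2 / Real.log 2) ^ t := by
  have hL := log_two_pos
  have h1 : |(hQ t c : ℝ)| ≤ 2 ^ t * fubini t := by exact_mod_cast abs_hQ_le h
  have h2 := fubini_mul_log_two_pow_div_factorial_le_one t
  rw [abs_div, Nat.abs_cast, div_pow, div_le_div_iff₀ (by positivity) (by positivity)]
  rw [div_le_one (by positivity)] at h2
  calc |(hQ t c : ℝ)| * Real.log 2 ^ t ≤ 2 ^ t * fubini t * Real.log 2 ^ t := by gcongr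
    _ = 2 ^ t * (fubini t * Real.log 2 ^ t) := by ring
    _ ≤ 2 ^ t * t.factorial := by gcongr

/-- The normalised summand of `qr n` with `t = 2 * c + s` and `n = N + t`. -/
noncomputable def qTerm (N c s : ℕ) : ℝ :=
  factorialWeight N c s * (4 * Real.log 2 ^ 2 * ((hQ (2 * c + s) c : ℝ) / (2 * c + s).factorial) *
    Real.log 2 ^ (2 * (c + s)) * genFubiniConv (N + c) c)

lemma qTerm_eq (N c s : ℕ) :
    qTerm N c s = (((N + (2 * c + s)).choose (2 * c + s) : ℚ) * hQ (2 * c + s) c *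
      (∑ j ∈ range (c + 1), ((genFubini (N + c) j : ℚ) * (genFubini (N + c) (c - j) : ℚ)) /
        ((j.factorial : ℚ) * ((c - j).factorial : ℚ))) : ℚ) * 4 *
      Real.log 2 ^ (2 * (N + (2 * c + s)) + 2) / ((N + (2 * c + s)).factorial : ℝ) ^ 2 := by
  have hconv : genFubiniConv (N + c) c = (∑ j ∈ range (c + 1),
      ((genFubini (N + c) j : ℝ) * (genFubini (N + c) (c - j) : ℝ)) /
        ((j.factorial : ℝ) * ((c - j).factorial : ℝ))) *
        (Real.log 2 ^ (N + c) / (N + c).factorial) ^ 2 := by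
    rw [genFubiniConv, Finset.sum_mul]
    refine Finset.sum_congr rfl fun j _ => ?_
    unfold genFubiniRatio
    ring
  have hch : ((N + (2 * c + s)).choose (2 * c + s) : ℝ) =
      (N + (2 * c + s)).factorial / (N.factorial * (2 * c + s).factorial) := by
    rw [Nat.add_choose, Nat.cast_div (Nat.factorial_mul_factorial_dvd_factorial_add _ _)
      (by positivity), Nat.cast_mul]
  rw [qTerm, hconv, factorialWeight]
  push_cast
  rw [hch]
  generalize ∑ j ∈ range (c + 1), ((genFubini (N + c) j : ℝ) * (genFubini (N + c) (c - j) : ℝ)) /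
        ((j.factorial : ℝ) * ((c - j).factorial : ℝ)) = Y
  have h1 : (N.factorial : ℝ) ≠ 0 := by positivity
  have h2 : ((N + c).factorial : ℝ) ≠ 0 := by positivity
  have h3 : ((N + (2 * c + s)).factorial : ℝ) ≠ 0 := by positivity
  have h4 : ((2 * c + s).factorial : ℝ) ≠ 0 := by positivity
  field_simp
  ring

lemma qr_mul_eq_tsum (n : ℕ) :
    (qr n : ℝ) * 4 * Real.log 2 ^ (2 * n + 2) / (n.factorial : ℝ) ^ 2 =
      ∑' p : ℕ × ℕ, if 2 * p.1 + p.2 ≤ n then qTerm (n - (2 * p.1 + p.2)) p.1 p.2 else 0 := by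
  rw [tsum_eq_sum (s := range (n + 1) ×ˢ range (n + 1))]
  swap
  · intro p hp
    rw [if_neg]
    simp only [mem_product, mem_range] at hp
    omega
  rw [Finset.sum_product]
  have hsub : range (n / 2 + 1) ⊆ range (n + 1) := Finset.range_mono (by omega)
  rw [← Finset.sum_subset hsub]
  swap
  · intro c _ hc
    refine Finset.sum_eq_zero fun s _ => if_neg ?_
    rw [mem_range] at hc
    omega
  unfold qr
  rw [Rat.cast_sum, Finset.sum_mul, Finset.sum_mul, Finset.sum_div]
  refine Finset.sum_congr rfl fun c hc => ?_
  have hc' : 2 * c ≤ n := by rw [mem_range] at hc; omega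
  rw [← Finset.Ico_add_one_right_eq_Icc, Finset.sum_Ico_eq_sum_range, Rat.cast_sum,
    Finset.sum_mul, Finset.sum_mul, Finset.sum_div,
    ← Finset.sum_subset (Finset.range_mono (show n + 1 - 2 * c ≤ n + 1 by omega))]
  swap
  · intro s _ hs
    refine if_neg ?_
    rw [mem_range] at hs
    simp only
    omega
  refine Finset.sum_congr rfl fun s hs => ?_
  rw [mem_range] at hs
  obtain ⟨N, rfl⟩ := Nat.exists_eq_add_of_le' (show 2 * c + s ≤ n by omega)
  rw [if_pos (by simp), Nat.add_sub_cancel, qTerm_eq]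

lemma abs_qTerm_le (N c s : ℕ) :
    |qTerm N c s| ≤ factorialWeight N c s *
      (4 * Real.log 2 ^ 2 * (8 ^ c / c.factorial * (2 * Real.log 2) ^ s)) := by
  have hL := log_two_pos
  rw [qTerm, abs_mul, abs_of_nonneg (factorialWeight_nonneg _ _ _)]
  refine mul_le_mul_of_nonneg_left ?_ (factorialWeight_nonneg _ _ _)
  rw [abs_mul, abs_mul, abs_mul, abs_of_nonneg (genFubiniConv_nonneg _ _),
    abs_of_nonneg (show 0 ≤ 4 * Real.log 2 ^ 2 by positivity),
    abs_of_nonneg (show 0 ≤ Real.log 2 ^ (2 * (c + s)) by positivity)]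
  calc 4 * Real.log 2 ^ 2 * |(hQ (2 * c + s) c : ℝ) / (2 * c + s).factorial| *
        Real.log 2 ^ (2 * (c + s)) * genFubiniConv (N + c) c
      ≤ 4 * Real.log 2 ^ 2 * (2 / Real.log 2) ^ (2 * c + s) *
        Real.log 2 ^ (2 * (c + s)) * (2 ^ c / c.factorial) := by
        have h1 := abs_hQ_div_factorial_le (show 2 * c ≤ 2 * c + s by omega)
        have h2 := genFubiniConv_le (N + c) c
        have h3 := genFubiniConv_nonneg (N + c) c
        gcongr
    _ = 4 * Real.log 2 ^ 2 * (8 ^ c / c.factorial * (2 * Real.log 2) ^ s) := by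
        have e : (8 : ℝ) ^ c = 2 ^ (2 * c) * 2 ^ c := by
          rw [pow_mul, ← mul_pow]; norm_num
        have : (c.factorial : ℝ) ≠ 0 := by positivity
        rw [e, div_pow, pow_add (2 : ℝ), mul_add, pow_add (Real.log 2) (2 * c) s,
          pow_add (Real.log 2) (2 * c) (2 * s), mul_pow, mul_comm 2 s, pow_mul (Real.log 2) s 2]
        field_simp

lemma tendsto_qTerm_zero (c : ℕ) :
    Tendsto (fun N => qTerm N c 0) atTop (𝓝 ((-Real.log 2 ^ 2) ^ c / c.factorial)) := by
  have h := (tendsto_factorialWeight_zero_right c).mul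
    (((tendsto_genFubiniConv c).comp (tendsto_add_atTop_nat c)).const_mul
      (4 * Real.log 2 ^ 2 * ((hQ (2 * c + 0) c : ℝ) / (2 * c + 0).factorial) *
        Real.log 2 ^ (2 * (c + 0))))
  have e : 1 * (4 * Real.log 2 ^ 2 * ((hQ (2 * c + 0) c : ℝ) / (2 * c + 0).factorial) *
      Real.log 2 ^ (2 * (c + 0)) * (1 / (4 * Real.log 2 ^ 2 * c.factorial))) =
      (-Real.log 2 ^ 2) ^ c / c.factorial := by
    have h1 : ((2 * c).factorial : ℝ) ≠ 0 := by positivity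
    have h2 : (c.factorial : ℝ) ≠ 0 := by positivity
    have hL := log_two_pos.ne'
    rw [add_zero, add_zero, hQ_two_mul_self,
      neg_pow (Real.log 2 ^ 2), ← pow_mul]
    push_cast
    field_simp
  rw [e] at h
  exact h

lemma tendsto_qTerm_succ (c s : ℕ) :
    Tendsto (fun N => qTerm N c (s + 1)) atTop (𝓝 0) := by
  have hL := log_two_pos
  refine squeeze_zero_norm (a := fun N => 1 / (N + (2 * c + (s + 1)) : ℕ) *
    (4 * Real.log 2 ^ 2 * (8 ^ c / c.factorial * (2 * Real.log 2) ^ (s + 1)))) (fun N => ?_) ?_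
  · rw [Real.norm_eq_abs]
    exact (abs_qTerm_le N c (s + 1)).trans
      (mul_le_mul_of_nonneg_right (factorialWeight_succ_le N c s) (by positivity))
  · have h := (tendsto_const_div_atTop_nhds_zero_nat (1 : ℝ)).comp
      (tendsto_add_atTop_nat (2 * c + (s + 1)))
    simpa using h.mul_const
      (4 * Real.log 2 ^ 2 * (8 ^ c / c.factorial * (2 * Real.log 2) ^ (s + 1)))

lemma tendsto_qr_mul :
    Tendsto (fun n : ℕ => (qr n : ℝ) * 4 * Real.log 2 ^ (2 * n + 2) / (n.factorial : ℝ) ^ 2)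
      atTop (𝓝 (Real.exp (-Real.log 2 ^ 2))) := by
  have hL := log_two_pos
  have hlim : ∑' p : ℕ × ℕ, (if p.2 = 0 then (-Real.log 2 ^ 2) ^ p.1 / (p.1.factorial : ℝ) else 0) =
      Real.exp (-Real.log 2 ^ 2) := by
    refine HasSum.tsum_eq ?_
    have hinj : Function.Injective fun c : ℕ => (c, 0) := fun a b h => (Prod.ext_iff.1 h).1
    rw [← hinj.hasSum_iff]
    · rw [Real.exp_eq_exp_ℝ]
      simpa [Function.comp_def] using NormedSpace.expSeries_div_hasSum_exp (-Real.log 2 ^ 2)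
    · rintro ⟨c, s⟩ hp
      exact if_neg fun hs : s = 0 => hp ⟨c, by rw [hs]⟩
  rw [← hlim]
  simp_rw [qr_mul_eq_tsum]
  refine tendsto_tsum_of_dominated_convergence (bound := fun p : ℕ × ℕ =>
    4 * Real.log 2 ^ 2 * (8 ^ p.1 / p.1.factorial * ((2 * Real.log 2) ^ p.2 / p.2.factorial)))
    ?_ ?_ ?_
  · exact ((Real.summable_pow_div_factorial 8).mul_of_nonneg
      (Real.summable_pow_div_factorial (2 * Real.log 2)) (fun _ => by positivity)
      (fun _ => by positivity)).mul_left _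
  · rintro ⟨c, s⟩
    have h : Tendsto (fun N => qTerm N c s) atTop
        (𝓝 (if s = 0 then (-Real.log 2 ^ 2) ^ c / (c.factorial : ℝ) else 0)) := by
      cases s with
      | zero => exact tendsto_qTerm_zero c
      | succ s => exact tendsto_qTerm_succ c s
    refine (h.comp (tendsto_sub_atTop_nat (2 * c + s))).congr' ?_
    filter_upwards [eventually_ge_atTop (2 * c + s)] with n hn
    rw [if_pos hn]
    rfl
  · refine Eventually.of_forall fun n p => ?_
    split_ifs
    · refine (abs_qTerm_le _ _ _).trans ((mul_le_mul_of_nonneg_right (factorialWeight_le _ _ _)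
        (by positivity)).trans_eq ?_)
      field_simp
    · rw [norm_zero]
      positivity

theorem qn_asymptotic :
    Filter.Tendsto
      (fun n : ℕ => (qr n : ℝ) * 4 * (Real.log 2) ^ (2 * n + 2) /
        ((Nat.factorial n : ℝ)) ^ 2)
      Filter.atTop (nhds (Real.exp (-(Real.log 2) ^ 2))) ∧
    Filter.Tendsto
      (fun n : ℕ => (qr n : ℝ) / ((fubini n : ℝ)) ^ 2)
      Filter.atTop (nhds (Real.exp (-(Real.log 2) ^ 2))) := by
  refine ⟨tendsto_qr_mul, ?_⟩
  have hL := log_two_pos.ne'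
  have h1 : Tendsto (fun n : ℕ => (2 * Real.log 2 *
      ((fubini n : ℝ) * Real.log 2 ^ n / n.factorial)) ^ 2) atTop (𝓝 1) := by
    have h := (tendsto_fubini_mul_log_two_pow_div_factorial.const_mul (2 * Real.log 2)).pow 2
    rwa [mul_one_div_cancel (by positivity), one_pow] at h
  have h2 := tendsto_qr_mul.div h1 one_ne_zero
  rw [div_one] at h2
  refine h2.congr fun n => ?_
  have h3 : (n.factorial : ℝ) ≠ 0 := by positivity
  rw [Pi.div_apply]
  field_simp
  ring
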